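/- arXiv:2203.08987 — 4 statements merged into one kernel-verified Lean document; each statement's English description precedes it below -/
import Mathlib

section
/- For all integers $m$ and $n$ with $|m| \geq n/2 - 2$, the number $N(m,n)$ of partitions of $n$ with rank equal to $m$ satisfies $N(m,n) = g(n - |m|)$, where $g(k)$ denotes the number of partitions of $k$ for which the number of parts occurs as a part. -/
/-- The Dyson rank of a partition: its largest part minus its number of parts. -/
def Nat.Partition.rank {n : ℕ} (l : n.Partition) : ℤ :=
  (l.parts.sup : ℤ) - l.parts.card

/-- `N m n`: the number of partitions of `n` with rank exactly `m`
(`0` when `n` is not a positive integer). -/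
noncomputable def rankCount (m n : ℤ) : ℕ :=
  if 0 < n then Nat.card {l : Nat.Partition n.toNat // l.rank = m} else 0

/-- `g k`: the number of partitions of `k` for which the number of parts occurs as a part
(`0` when `k` is not a positive integer). -/
noncomputable def g (k : ℤ) : ℕ :=
  if 0 < k then
    Nat.card {l : Nat.Partition k.toNat // (l.parts.card : ℕ) ∈ l.parts}
  else 0

namespace Multiset

theorem sup_mem_of_ne_zero {α : Type*} [LinearOrder α] [OrderBot α] {s : Multiset α}
    (hs : s ≠ 0) : s.sup ∈ s := by
  induction s using Multiset.induction_on with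
  | empty => exact absurd rfl hs
  | cons a s ih =>
    rw [sup_cons]
    rcases eq_or_ne s 0 with rfl | h
    · simp
    · rcases max_choice a s.sup with h' | h' <;> rw [h']
      · exact mem_cons_self a s
      · exact mem_cons_of_mem (ih h)

end Multiset

namespace YoungDiagram

theorem card_eq_sum_rowLens (μ : YoungDiagram) : μ.card = μ.rowLens.sum := by
  have hmaps : ∀ c ∈ μ.cells, c.1 ∈ Finset.range (μ.colLen 0) := fun c hc ↦
    Finset.mem_range.2 <| mem_iff_lt_colLen.1 <| μ.up_left_mem le_rfl c.2.zero_le hc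
  rw [YoungDiagram.card, Finset.card_eq_sum_card_fiberwise hmaps, rowLens,
    ← Multiset.sum_coe]
  exact Finset.sum_congr rfl fun i _ ↦ μ.rowLen_eq_card.symm

theorem sup_rowLens (μ : YoungDiagram) : (μ.rowLens : Multiset ℕ).sup = μ.rowLen 0 := by
  apply le_antisymm
  · refine Multiset.sup_le.2 fun x hx ↦ ?_
    obtain ⟨i, -, rfl⟩ := List.mem_map.1 (Multiset.mem_coe.1 hx)
    exact μ.rowLen_anti 0 i i.zero_le
  · rcases Nat.eq_zero_or_pos (μ.rowLen 0) with h | h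
    · simp [h]
    · refine Multiset.le_sup (Multiset.mem_coe.2 (List.mem_map.2 ⟨0, ?_, rfl⟩))
      exact List.mem_range.2 (mem_iff_lt_colLen.1 (mem_iff_lt_rowLen.2 h))

@[simp]
theorem card_transpose (μ : YoungDiagram) : μ.transpose.card = μ.card := by
  simp [YoungDiagram.card, transpose]

/-- Young diagrams with `n` cells correspond to partitions of `n`, via their row lengths. -/
def equivPartition (n : ℕ) : {μ : YoungDiagram // μ.card = n} ≃ n.Partition where
  toFun μ :=
    { parts := μ.1.rowLens
      parts_pos := fun h ↦ μ.1.pos_of_mem_rowLens _ h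
      parts_sum := by rw [Multiset.sum_coe, ← card_eq_sum_rowLens, μ.2] }
  invFun l :=
    ⟨ofRowLens (l.parts.sort (· ≥ ·)) (Multiset.pairwise_sort _ _).sortedGE, by
      rw [card_eq_sum_rowLens,
        rowLens_ofRowLens_eq_self fun x hx ↦ l.parts_pos ((Multiset.mem_sort _).1 hx),
        ← Multiset.sum_coe, Multiset.sort_eq, l.parts_sum]⟩
  left_inv μ := by
    apply Subtype.ext
    apply equivListRowLens.injective
    apply Subtype.ext
    simp only [equivListRowLens_apply_coe]
    rw [rowLens_ofRowLens_eq_self]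
    · exact List.mergeSort_eq_self _ (by simpa using μ.1.rowLens_sorted.pairwise)
    · exact fun x hx ↦ μ.1.pos_of_mem_rowLens _ ((Multiset.mem_sort _).1 hx)
  right_inv l := by
    ext1
    simp only
    rw [rowLens_ofRowLens_eq_self fun x hx ↦ l.parts_pos ((Multiset.mem_sort _).1 hx),
      Multiset.sort_eq]

theorem rank_equivPartition {n : ℕ} (μ : {μ : YoungDiagram // μ.card = n}) :
    (equivPartition n μ).rank = (μ.1.rowLen 0 : ℤ) - μ.1.colLen 0 := by
  simp only [Nat.Partition.rank, equivPartition, Equiv.coe_fn_mk, sup_rowLens,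
    Multiset.coe_card, length_rowLens]

/-- Transposition of Young diagrams with `n` cells. -/
def transposeEquiv (n : ℕ) : Equiv.Perm {μ : YoungDiagram // μ.card = n} :=
  transposeOrderIso.toEquiv.subtypeEquiv fun μ ↦ by simp

end YoungDiagram

namespace Nat.Partition

/-- The conjugation of partitions of `n`. -/
def conjugate (n : ℕ) : Equiv.Perm n.Partition :=
  (YoungDiagram.equivPartition n).permCongr (YoungDiagram.transposeEquiv n)

theorem rank_conjugate {n : ℕ} (l : n.Partition) : (conjugate n l).rank = -l.rank := by
  obtain ⟨μ, rfl⟩ := (YoungDiagram.equivPartition n).surjective l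
  simp [conjugate, Equiv.permCongr_apply, YoungDiagram.rank_equivPartition,
    YoungDiagram.transposeEquiv]

theorem card_rank_neg (n : ℕ) (m : ℤ) :
    Nat.card {l : n.Partition // l.rank = -m} = Nat.card {l : n.Partition // l.rank = m} :=
  Nat.card_congr <| (conjugate n).subtypeEquiv fun l ↦ by rw [rank_conjugate]; omega

theorem parts_ne_zero {n : ℕ} (hn : n ≠ 0) (l : n.Partition) : l.parts ≠ 0 := by
  intro h
  exact hn (by simpa [h] using l.parts_sum.symm)

theorem sup_parts_mem {n : ℕ} (hn : n ≠ 0) (l : n.Partition) : l.parts.sup ∈ l.parts :=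
  Multiset.sup_mem_of_ne_zero (l.parts_ne_zero hn)

theorem rank_lt {n : ℕ} (hn : n ≠ 0) (l : n.Partition) : l.rank < n := by
  have h₁ := le_of_mem_parts (l.sup_parts_mem hn)
  have h₂ := Multiset.card_pos.2 (l.parts_ne_zero hn)
  unfold rank
  omega

theorem le_card_add_of_mem_erase_card {k M p : ℕ} (hk : k ≤ M + 4) (l : k.Partition)
    (hc : l.parts.card ∈ l.parts) (hp : p ∈ l.parts.erase l.parts.card) :
    p ≤ l.parts.card + M := by
  obtain ⟨t, ht⟩ := Multiset.exists_cons_of_mem hp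
  have hl := Multiset.cons_erase hc
  rw [ht] at hl
  have hcard := congrArg Multiset.card hl
  have hsum := congrArg Multiset.sum hl
  have htsum : t.card ≤ t.sum := by
    simpa using Multiset.card_nsmul_le_sum (s := t) (a := 1) fun x hx ↦ l.parts_pos <| by
      rw [← hl]; simp [hx]
  simp only [Multiset.card_cons, Multiset.sum_cons, l.parts_sum] at hcard hsum
  omega

/-- When `k ≤ M + 4`, replacing the largest part by the number of parts is a bijection from
partitions of `k + M` of rank `M` to partitions of `k` whose number of parts is a part. -/
def rankEquiv {k M : ℕ} (hk₀ : k ≠ 0) (hk : k ≤ M + 4) :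
    {l : (k + M).Partition // l.rank = M} ≃ {l : k.Partition // l.parts.card ∈ l.parts} where
  toFun l :=
    have hmem := l.1.sup_parts_mem (by omega)
    have hsup : l.1.parts.sup = l.1.parts.card + M := by
      have := l.2
      unfold rank at this
      omega
    have hpos := Multiset.card_pos.2 (l.1.parts_ne_zero (by omega))
    ⟨{  parts := l.1.parts.card ::ₘ l.1.parts.erase l.1.parts.sup
        parts_pos := fun {i} hi ↦ by
          rcases Multiset.mem_cons.1 hi with rfl | hi
          · exact hpos
          · exact l.1.parts_pos (Multiset.mem_of_mem_erase hi)
        parts_sum := by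
          have h := congrArg Multiset.sum (Multiset.cons_erase hmem)
          rw [Multiset.sum_cons, l.1.parts_sum] at h
          rw [Multiset.sum_cons]
          omega },
      by
        have h := congrArg Multiset.card (Multiset.cons_erase hmem)
        rw [Multiset.card_cons] at h
        simp only [Multiset.card_cons, h]
        exact Multiset.mem_cons_self _ _⟩
  invFun l :=
    have hpos := l.1.parts_pos l.2
    ⟨{  parts := (l.1.parts.card + M) ::ₘ l.1.parts.erase l.1.parts.card
        parts_pos := fun {i} hi ↦ by
          rcases Multiset.mem_cons.1 hi with rfl | hi
          · omega
          · exact l.1.parts_pos (Multiset.mem_of_mem_erase hi)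
        parts_sum := by
          have h := congrArg Multiset.sum (Multiset.cons_erase l.2)
          rw [Multiset.sum_cons, l.1.parts_sum] at h
          rw [Multiset.sum_cons]
          omega },
      by
        have h := congrArg Multiset.card (Multiset.cons_erase l.2)
        rw [Multiset.card_cons] at h
        have hs := Multiset.sup_le.2 fun p hp ↦ le_card_add_of_mem_erase_card hk l.1 l.2 hp
        simp only [rank, Multiset.card_cons, h, Multiset.sup_cons, sup_eq_left.2 hs]
        push_cast
        ring⟩
  left_inv l := by
    have hmem := l.1.sup_parts_mem (by omega)
    have hsup : l.1.parts.sup = l.1.parts.card + M := by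
      have := l.2
      unfold rank at this
      omega
    have h := congrArg Multiset.card (Multiset.cons_erase hmem)
    rw [Multiset.card_cons] at h
    apply Subtype.ext
    ext1
    simp only [Multiset.card_cons, h, Multiset.erase_cons_head]
    rw [← hsup, Multiset.cons_erase hmem]
  right_inv l := by
    have h := congrArg Multiset.card (Multiset.cons_erase l.2)
    rw [Multiset.card_cons] at h
    have hs := Multiset.sup_le.2 fun p hp ↦ le_card_add_of_mem_erase_card hk l.1 l.2 hp
    apply Subtype.ext
    ext1
    simp only [Multiset.card_cons, h, Multiset.sup_cons, sup_eq_left.2 hs,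
      Multiset.erase_cons_head]
    exact Multiset.cons_erase l.2

end Nat.Partition

theorem rankCount_neg (m n : ℤ) : rankCount (-m) n = rankCount m n := by
  simp only [rankCount, Nat.Partition.card_rank_neg]

theorem rankCount_abs (m n : ℤ) : rankCount |m| n = rankCount m n := by
  rcases abs_choice m with h | h <;> rw [h]
  exact rankCount_neg m n

theorem rankCount_eq_zero_of_le {m n : ℤ} (h : n ≤ m) : rankCount m n = 0 := by
  unfold rankCount
  split_ifs with hn
  · have : IsEmpty {l : Nat.Partition n.toNat // l.rank = m} :=
      ⟨fun l ↦ by have := l.1.rank_lt (by omega); have := l.2; omega⟩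
    exact Nat.card_of_isEmpty
  · rfl

theorem rankCount_add_eq_g {k M : ℕ} (hk₀ : k ≠ 0) (hk : k ≤ M + 4) :
    rankCount M (k + M) = g k := by
  have h : ((k : ℤ) + M).toNat = k + M := by omega
  rw [rankCount, g, if_pos (by omega), if_pos (by omega), h, Int.toNat_natCast]
  exact Nat.card_congr (Nat.Partition.rankEquiv hk₀ hk)

theorem rankCount_eq_g (m n : ℤ) (h : (n : ℚ) / 2 - 2 ≤ (|m| : ℚ)) :
    rankCount m n = g (n - |m|) := by
  have h' : n ≤ 2 * |m| + 4 := by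
    have : (n : ℚ) ≤ 2 * |(m : ℚ)| + 4 := by linarith
    exact_mod_cast this
  rw [← rankCount_abs]
  rcases le_or_gt n |m| with hle | hlt
  · rw [rankCount_eq_zero_of_le hle, g, if_neg (by omega)]
  · obtain ⟨M, hM⟩ := Int.eq_ofNat_of_zero_le (abs_nonneg m)
    obtain ⟨k, hk⟩ := Int.eq_ofNat_of_zero_le (sub_nonneg.2 hlt.le)
    rw [hk, ← rankCount_add_eq_g (k := k) (M := M) (by omega) (by omega), hM]
    congr 1
    omega
end

section
/- For every integer $n \geq 1$, the number of partitions $\lambda$ of $n$ with $\operatorname{rank}(\lambda) \geq n/2$ equals $p(\lfloor n/2 \rfloor - 1)$, where $p$ is the partition function with $p(0) = 1$ and $p(x) = 0$ for negative $x$. -/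
/-- The partition function `p`, extended to the integers by `p(x) = 0` when `x` is not a
non-negative integer (and `p 0 = 1`, counting the empty partition). -/
noncomputable def partitionFn (n : ℤ) : ℕ :=
  if 0 ≤ n then Nat.card (Nat.Partition n.toNat) else 0

theorem Multiset.sup_mem_of_ne_zero_s8 {s : Multiset ℕ} (hs : s ≠ 0) : s.sup ∈ s := by
  induction s using Multiset.induction_on with
  | empty => exact absurd rfl hs
  | cons a s ih =>
    rw [Multiset.sup_cons]
    rcases eq_or_ne s 0 with rfl | h
    · simp
    · rcases le_total a s.sup with h' | h'
      · rw [sup_eq_right.mpr h']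
        exact Multiset.mem_cons_of_mem (ih h)
      · rw [sup_eq_left.mpr h']
        exact Multiset.mem_cons_self a s

theorem Multiset.sup_le_sum (s : Multiset ℕ) : s.sup ≤ s.sum :=
  Multiset.sup_le.2 fun _ hi => Multiset.le_sum_of_mem hi

namespace Nat.Partition

variable {n m : ℕ}

/-- The parts of a partition other than (one copy of) the largest one. -/
def tail (l : n.Partition) : Multiset ℕ :=
  l.parts.erase l.parts.sup

theorem sup_cons_tail (hn : n ≠ 0) (l : n.Partition) : l.parts.sup ::ₘ l.tail = l.parts := by
  refine Multiset.cons_erase (Multiset.sup_mem_of_ne_zero_s8 fun h => hn ?_)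
  rw [← l.parts_sum, h, Multiset.sum_zero]

theorem sup_add_sum_tail (hn : n ≠ 0) (l : n.Partition) : l.parts.sup + l.tail.sum = n := by
  rw [← Multiset.sum_cons, l.sup_cons_tail hn, l.parts_sum]

theorem le_two_mul_rank_iff (hn : n ≠ 0) (l : n.Partition) :
    (n : ℤ) ≤ 2 * l.rank ↔ l.tail.sum + l.tail.card + 1 ≤ n / 2 := by
  have h₁ := l.sup_add_sum_tail hn
  have h₂ := congrArg Multiset.card (l.sup_cons_tail hn)
  rw [Multiset.card_cons] at h₂
  unfold rank
  omega

/-- A partition of rank at least `n / 2` is determined by its parts other than the largest one. -/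
def largeRankEquiv (hn : n / 2 = m + 1) :
    {l : n.Partition // (n : ℤ) ≤ 2 * l.rank} ≃
      {s : Multiset ℕ // (∀ i ∈ s, 0 < i) ∧ s.sum + s.card ≤ m} where
  toFun l := ⟨l.1.tail, fun _ hi => l.1.parts_pos (Multiset.mem_of_mem_erase hi), by
    have := (l.1.le_two_mul_rank_iff (by omega)).1 l.2
    omega⟩
  invFun s :=
    have hs : (n - s.1.sum) ⊔ s.1.sup = n - s.1.sum := by
      have := s.1.sup_le_sum
      have := s.2.2
      exact sup_eq_left.mpr (by omega)
    let l : n.Partition :=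
      { parts := (n - s.1.sum) ::ₘ s.1
        parts_pos := fun {i} hi => by
          rcases Multiset.mem_cons.1 hi with rfl | hi
          · have := s.2.2
            omega
          · exact s.2.1 i hi
        parts_sum := by
          have := s.2.2
          rw [Multiset.sum_cons]
          omega }
    ⟨l, by
      have ht : l.tail = s.1 := by simp [l, tail, hs]
      rw [l.le_two_mul_rank_iff (by omega), ht]
      have := s.2.2
      omega⟩
  left_inv l := by
    have hn₀ : n ≠ 0 := by omega
    apply Subtype.ext
    apply Nat.Partition.ext
    have h := l.1.sup_add_sum_tail hn₀
    change (n - l.1.tail.sum) ::ₘ l.1.tail = l.1.parts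
    rw [show n - l.1.tail.sum = l.1.parts.sup by omega, l.1.sup_cons_tail hn₀]
  right_inv s := by
    have hs : (n - s.1.sum) ⊔ s.1.sup = n - s.1.sum := by
      have := s.1.sup_le_sum
      have := s.2.2
      exact sup_eq_left.mpr (by omega)
    apply Subtype.ext
    simp [tail, hs]

theorem sum_map_succ (s : Multiset ℕ) : (s.map (· + 1)).sum = s.sum + s.card := by
  simp [Multiset.sum_map_add]

theorem map_succ_map_pred (l : m.Partition) :
    ((l.parts.filter (· ≠ 1)).map (· - 1)).map (· + 1) = l.parts.filter (· ≠ 1) := by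
  rw [Multiset.map_map]
  conv_rhs => rw [← Multiset.map_id (l.parts.filter (· ≠ 1))]
  refine Multiset.map_congr rfl fun i hi => ?_
  have := l.parts_pos (Multiset.mem_of_mem_filter hi)
  simp only [Function.comp_apply, id_eq]
  omega

theorem sum_filter_ne_one (l : m.Partition) :
    l.parts.count 1 + (l.parts.filter (· ≠ 1)).sum = m := by
  have h := congrArg Multiset.sum (Multiset.filter_add_not (· = 1) l.parts)
  rw [Multiset.sum_add, l.parts_sum, Multiset.filter_eq'] at h
  simpa using h

/-- Removing a unit from every part of a partition of `m`, and dropping the parts that vanish,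
gives a multiset of positive integers whose sum plus cardinality is at most `m`. -/
def predEquiv (m : ℕ) :
    m.Partition ≃ {s : Multiset ℕ // (∀ i ∈ s, 0 < i) ∧ s.sum + s.card ≤ m} where
  toFun l := ⟨(l.parts.filter (· ≠ 1)).map (· - 1), by
    intro i hi
    obtain ⟨j, hj, rfl⟩ := Multiset.mem_map.1 hi
    have := l.parts_pos (Multiset.mem_of_mem_filter hj)
    have := (Multiset.mem_filter.1 hj).2
    omega, by
    rw [← sum_map_succ, map_succ_map_pred]
    have := l.sum_filter_ne_one
    omega⟩
  invFun s :=
    { parts := Multiset.replicate (m - (s.1.sum + s.1.card)) 1 + s.1.map (· + 1)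
      parts_pos := fun {i} hi => by
        rcases Multiset.mem_add.1 hi with hi | hi
        · rw [Multiset.eq_of_mem_replicate hi]
          exact Nat.one_pos
        · obtain ⟨j, -, rfl⟩ := Multiset.mem_map.1 hi
          exact Nat.succ_pos j
      parts_sum := by
        have := s.2.2
        rw [Multiset.sum_add, sum_map_succ, Multiset.sum_replicate, smul_eq_mul]
        omega }
  left_inv l := by
    apply Nat.Partition.ext
    have h := l.sum_filter_ne_one
    simp only
    rw [← sum_map_succ, map_succ_map_pred,
      show m - (l.parts.filter (· ≠ 1)).sum = l.parts.count 1 by omega, ← Multiset.filter_eq']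
    exact Multiset.filter_add_not (· = 1) l.parts
  right_inv s := by
    apply Subtype.ext
    have h₁ : (Multiset.replicate (m - (s.1.sum + s.1.card)) 1).filter (· ≠ 1) = 0 :=
      Multiset.filter_eq_nil.2 fun i hi => by simp [Multiset.eq_of_mem_replicate hi]
    have h₂ : (s.1.map (· + 1)).filter (· ≠ 1) = s.1.map (· + 1) :=
      Multiset.filter_eq_self.2 fun i hi => by
        obtain ⟨j, hj, rfl⟩ := Multiset.mem_map.1 hi
        have := s.2.1 j hj
        omega
    simp only
    rw [Multiset.filter_add, h₁, h₂, zero_add, Multiset.map_map]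
    exact (Multiset.map_congr rfl fun _ _ => rfl).trans (Multiset.map_id s.1)

end Nat.Partition

theorem card_large_rank (n : ℤ) (hn : 1 ≤ n) :
    Nat.card {l : Nat.Partition n.toNat // (n : ℚ) / 2 ≤ (l.rank : ℚ)}
      = partitionFn (⌊(n : ℚ) / 2⌋ - 1) := by
  lift n to ℕ using by omega
  have hfloor : ⌊((n : ℤ) : ℚ) / 2⌋ = ((n / 2 : ℕ) : ℤ) := by
    have := Rat.floor_intCast_div_natCast (n : ℤ) 2
    push_cast at this ⊢
    exact this
  have hrank (l : n.Partition) : ((n : ℤ) : ℚ) / 2 ≤ (l.rank : ℚ) ↔ (n : ℤ) ≤ 2 * l.rank := by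
    rw [div_le_iff₀ two_pos, mul_comm]
    exact_mod_cast Iff.rfl
  simp only [Int.toNat_natCast, hfloor, hrank, partitionFn]
  rcases hm : n / 2 with _ | m
  · have : IsEmpty {l : n.Partition // (n : ℤ) ≤ 2 * l.rank} := ⟨fun l => by
      have := (l.1.le_two_mul_rank_iff (by omega)).1 l.2
      omega⟩
    simp
  · rw [if_pos (by omega), show (((m + 1 : ℕ) : ℤ) - 1).toNat = m by omega]
    exact Nat.card_congr
      ((Nat.Partition.largeRankEquiv hm).trans (Nat.Partition.predEquiv m).symm)
end

section
/- For every integer $k \geq 1$, there is a bijection between the set of partitions of $k$ for which the number of parts occurs as a part and the set of partitions of $k-1$ that contain no part equal to $1$; in particular, the two sets have the same cardinality. -/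
namespace Nat.Partition

/-- Erase one part equal to the number of parts, and increase every other part by one. -/
def eraseCardAddOne {k : ℕ} (p : {l : Nat.Partition k // l.parts.card ∈ l.parts}) :
    {l : Nat.Partition (k - 1) // 1 ∉ l.parts} where
  val :=
    { parts := (p.1.parts.erase p.1.parts.card).map (· + 1)
      parts_pos := by
        intro i hi
        obtain ⟨a, -, rfl⟩ := Multiset.mem_map.1 hi
        exact Nat.succ_pos a
      parts_sum := by
        have h_sum := Multiset.sum_erase p.2
        have h_card := Multiset.card_erase_add_one p.2
        rw [p.1.parts_sum] at h_sum
        simp only [Multiset.sum_map_add, Multiset.map_id', Multiset.map_const',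
          Multiset.sum_replicate, smul_eq_mul, mul_one]
        omega }
  property h := by
    obtain ⟨a, ha, h_eq⟩ := Multiset.mem_map.1 h
    have := p.1.parts_pos (Multiset.mem_of_mem_erase ha)
    omega

/-- Decrease every part by one, and insert the resulting number of parts as a new part. -/
def insertCardSubOne {k : ℕ} (hk : 1 ≤ k) (p : {l : Nat.Partition (k - 1) // 1 ∉ l.parts}) :
    {l : Nat.Partition k // l.parts.card ∈ l.parts} where
  val :=
    { parts := (p.1.parts.card + 1) ::ₘ p.1.parts.map (· - 1)
      parts_pos := by
        intro i hi
        rcases Multiset.mem_cons.1 hi with rfl | hi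
        · exact Nat.succ_pos _
        · obtain ⟨a, ha, rfl⟩ := Multiset.mem_map.1 hi
          have h_pos := p.1.parts_pos ha
          have h_ne : a ≠ 1 := fun h => p.2 (h ▸ ha)
          omega
      parts_sum := by
        have h_sum : (p.1.parts.map fun a => a - 1 + 1).sum = k - 1 := by
          rw [Multiset.map_congr rfl fun a ha => Nat.sub_add_cancel (p.1.parts_pos ha),
            Multiset.map_id', p.1.parts_sum]
        simp only [Multiset.sum_map_add, Multiset.map_const', Multiset.sum_replicate,
          smul_eq_mul, mul_one] at h_sum
        rw [Multiset.sum_cons]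
        omega }
  property := by simp

/-- Partitions of `k` having their number of parts as a part correspond to partitions of `k - 1`
without parts equal to `1`. -/
def cardMemPartsEquiv {k : ℕ} (hk : 1 ≤ k) :
    {l : Nat.Partition k // l.parts.card ∈ l.parts} ≃
      {l : Nat.Partition (k - 1) // 1 ∉ l.parts} where
  toFun := eraseCardAddOne
  invFun := insertCardSubOne hk
  left_inv p := by
    apply Subtype.ext
    apply Nat.Partition.ext
    simp only [insertCardSubOne, eraseCardAddOne, Multiset.card_map, Multiset.map_map,
      Function.comp_def, Nat.add_sub_cancel, Multiset.map_id', Multiset.card_erase_add_one p.2]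
    exact Multiset.cons_erase p.2
  right_inv p := by
    apply Subtype.ext
    apply Nat.Partition.ext
    simp only [insertCardSubOne, eraseCardAddOne, Multiset.card_cons, Multiset.card_map,
      Multiset.erase_cons_head, Multiset.map_map, Function.comp_def]
    rw [Multiset.map_congr rfl fun a ha => Nat.sub_add_cancel (p.1.parts_pos ha),
      Multiset.map_id']

end Nat.Partition

theorem partitions_numParts_mem_equiv_no_one_part (k : ℕ) (hk : 1 ≤ k) :
    Nonempty
      ({l : Nat.Partition k // (l.parts.card : ℕ) ∈ l.parts}
        ≃ {l : Nat.Partition (k - 1) // (1 : ℕ) ∉ l.parts}) ∧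
      Nat.card {l : Nat.Partition k // (l.parts.card : ℕ) ∈ l.parts}
        = Nat.card {l : Nat.Partition (k - 1) // (1 : ℕ) ∉ l.parts} :=
  ⟨⟨Nat.Partition.cardMemPartsEquiv hk⟩, Nat.card_congr (Nat.Partition.cardMemPartsEquiv hk)⟩
end

section
/- For every integer $n \geq 0$, $N^+(1, 23, 46n + 47) + N^+(-2, 23, 46n + 54) = N^+(3, 23, 46n + 49) + N^+(4, 23, 46n + 29)$. -/
/-- `N⁺ r m n`: the number of partitions of `n` whose rank is congruent to `r` modulo `m`
and has absolute value at least `n / 2` (`0` when `n` is not a positive integer). -/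
noncomputable def rankCountPlus (r m n : ℤ) : ℕ :=
  if 0 < n then
    Nat.card {l : Nat.Partition n.toNat //
      l.rank ≡ r [ZMOD m] ∧ (n : ℚ) / 2 ≤ |(l.rank : ℚ)|}
  else 0

theorem YoungDiagram.sum_rowLens (μ : YoungDiagram) : μ.rowLens.sum = μ.card := by
  have h : ∀ c ∈ μ.cells, c.1 ∈ Finset.range (μ.colLen 0) := fun c hc => by
    rw [Finset.mem_range, ← mem_iff_lt_colLen]
    exact μ.up_left_mem le_rfl (Nat.zero_le _) hc
  rw [YoungDiagram.card, Finset.card_eq_sum_card_fiberwise h, rowLens]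
  calc (List.map μ.rowLen (List.range (μ.colLen 0))).sum
      = ∑ i ∈ Finset.range (μ.colLen 0), μ.rowLen i := rfl
    _ = _ := Finset.sum_congr rfl fun i _ => μ.rowLen_eq_card

theorem YoungDiagram.sup_rowLens_s16 (μ : YoungDiagram) :
    (μ.rowLens : Multiset ℕ).sup = μ.rowLen 0 := by
  refine le_antisymm (Multiset.sup_le.2 fun b hb => ?_) ?_
  · obtain ⟨i, -, rfl⟩ := List.mem_map.1 (Multiset.mem_coe.1 hb)
    exact μ.rowLen_anti 0 i (Nat.zero_le _)
  · rcases Nat.eq_zero_or_pos (μ.rowLen 0) with h | h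
    · simp [h]
    · refine Multiset.le_sup (Multiset.mem_coe.2 (List.mem_map.2 ⟨0, ?_, rfl⟩))
      rwa [List.mem_range, ← mem_iff_lt_colLen, mem_iff_lt_rowLen]

/-- Young diagrams with `n` cells correspond to partitions of `n` through their row lengths. -/
def Nat.Partition.equivYoungDiagram (n : ℕ) : {μ : YoungDiagram // μ.card = n} ≃ n.Partition where
  toFun μ := ⟨μ.1.rowLens, fun hi => μ.1.pos_of_mem_rowLens _ (Multiset.mem_coe.1 hi), by
    rw [Multiset.sum_coe, μ.1.sum_rowLens, μ.2]⟩
  invFun l := ⟨YoungDiagram.ofRowLens (l.parts.sort (· ≥ ·))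
      (Multiset.pairwise_sort _ _).sortedGE, by
    rw [← YoungDiagram.sum_rowLens, YoungDiagram.rowLens_ofRowLens_eq_self, ← Multiset.sum_coe,
      Multiset.sort_eq, l.parts_sum]
    exact fun x hx => l.parts_pos ((Multiset.mem_sort _).1 hx)⟩
  left_inv μ := by
    have h : (μ.1.rowLens : Multiset ℕ).sort (· ≥ ·) = μ.1.rowLens := by
      rw [Multiset.coe_sort]
      exact List.mergeSort_of_pairwise (by simpa using μ.1.rowLens_sorted.pairwise)
    apply Subtype.ext
    simp only [h]
    exact YoungDiagram.ofRowLens_to_rowLens_eq_self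
  right_inv l := by
    apply Nat.Partition.ext
    simp only
    rw [YoungDiagram.rowLens_ofRowLens_eq_self, Multiset.sort_eq]
    exact fun x hx => l.parts_pos ((Multiset.mem_sort _).1 hx)

theorem Nat.Partition.rank_equivYoungDiagram {n : ℕ} (μ : {μ : YoungDiagram // μ.card = n}) :
    (equivYoungDiagram n μ).rank = (μ.1.rowLen 0 : ℤ) - μ.1.colLen 0 := by
  change (((μ.1.rowLens : Multiset ℕ).sup : ℕ) : ℤ) - (μ.1.rowLens : Multiset ℕ).card = _
  rw [YoungDiagram.sup_rowLens_s16, Multiset.coe_card, YoungDiagram.length_rowLens]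

theorem YoungDiagram.card_transpose_s16 (μ : YoungDiagram) : μ.transpose.card = μ.card := by
  simp [YoungDiagram.card, transpose]

/-- Conjugation of partitions, as a permutation of the partitions of `n`. -/
def Nat.Partition.conjugate_s16 (n : ℕ) : n.Partition ≃ n.Partition :=
  (equivYoungDiagram n).symm.trans <|
    (YoungDiagram.transposeOrderIso.toEquiv.subtypeEquiv fun μ => by
      simp [YoungDiagram.card_transpose_s16]).trans (equivYoungDiagram n)

theorem Nat.Partition.rank_conjugate_s16 {n : ℕ} (l : n.Partition) :
    (conjugate_s16 n l).rank = -l.rank := by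
  obtain ⟨μ, rfl⟩ := (equivYoungDiagram n).surjective l
  simp [conjugate_s16, rank_equivYoungDiagram]

theorem Nat.Partition.sup_mem_parts {n : ℕ} (hn : 0 < n) (l : n.Partition) :
    l.parts.sup ∈ l.parts := by
  have h : l.parts.toFinset.Nonempty := by
    rw [Finset.nonempty_iff_ne_empty, Ne, Multiset.toFinset_eq_empty]
    intro h
    have := l.parts_sum
    simp [h] at this
    omega
  obtain ⟨x, hx, hsup⟩ := Finset.exists_mem_eq_sup _ h id
  rw [Multiset.mem_toFinset] at hx
  rw [Finset.sup_def, Multiset.toFinset_val, Multiset.map_id, Multiset.sup_dedup] at hsup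
  rwa [hsup]

/-- Partitions of large rank are determined by the parts left after removing a largest part. -/
def Nat.Partition.equivEraseLargest {n : ℕ} (hn : 0 < n) (P : ℤ → Prop) :
    {l : n.Partition // P l.rank ∧ (n : ℤ) ≤ 2 * l.rank} ≃
      {s : Multiset ℕ // (∀ x ∈ s, 0 < x) ∧ P (n - 1 - (s.sum + s.card)) ∧
        (n : ℤ) ≤ 2 * (n - 1 - (s.sum + s.card))} where
  toFun l := ⟨l.1.parts.erase l.1.parts.sup,
      fun x hx => l.1.parts_pos (Multiset.mem_of_mem_erase hx), by
    have hmem := l.1.sup_mem_parts hn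
    have hsum := Multiset.sum_erase hmem
    have hcard := Multiset.card_erase_add_one hmem
    rw [l.1.parts_sum] at hsum
    have hrank : (n : ℤ) - 1 - ((l.1.parts.erase l.1.parts.sup).sum +
        (l.1.parts.erase l.1.parts.sup).card) = l.1.rank := by
      rw [Nat.Partition.rank]
      omega
    rw [hrank]
    exact l.2⟩
  invFun s := ⟨⟨(n - s.1.sum) ::ₘ s.1, by
      have h := s.2.2.2
      intro i hi
      rcases Multiset.mem_cons.1 hi with rfl | hi
      · omega
      · exact s.2.1 i hi, by
      have h := s.2.2.2
      rw [Multiset.sum_cons]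
      omega⟩, by
    have h := s.2.2.2
    have hsup : s.1.sup ≤ s.1.sum := Multiset.sup_le.2 fun b hb => Multiset.le_sum_of_mem hb
    have hrank : (((n - s.1.sum) ::ₘ s.1).sup : ℤ) - ((n - s.1.sum) ::ₘ s.1).card =
        n - 1 - (s.1.sum + s.1.card) := by
      rw [Multiset.sup_cons, Multiset.card_cons, sup_eq_left.2 (by omega)]
      omega
    simp only [Nat.Partition.rank, hrank]
    exact s.2.2⟩
  left_inv l := by
    have hmem := l.1.sup_mem_parts hn
    have hsum := Multiset.sum_erase hmem
    rw [l.1.parts_sum] at hsum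
    apply Subtype.ext
    apply Nat.Partition.ext
    simp only
    rw [← Nat.eq_sub_of_add_eq hsum, Multiset.cons_erase hmem]
  right_inv s := by
    have h := s.2.2.2
    have hsup : s.1.sup ≤ s.1.sum := Multiset.sup_le.2 fun b hb => Multiset.le_sum_of_mem hb
    apply Subtype.ext
    simp only
    rw [Multiset.sup_cons, sup_eq_left.2 (by omega), Multiset.erase_cons_head]

/-- The number of multisets of positive integers whose sum plus cardinality satisfies `P`. -/
noncomputable def weightCount (P : ℤ → Prop) : ℕ :=
  Nat.card {s : Multiset ℕ // (∀ x ∈ s, 0 < x) ∧ P (s.sum + s.card)}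

theorem rankCountPlus_eq_weightCount {n : ℤ} (hn : 0 < n) (r m : ℤ) :
    rankCountPlus r m n =
      weightCount (fun w => n - 1 - w ≡ r [ZMOD m] ∧ n ≤ 2 * (n - 1 - w)) +
      weightCount (fun w => n - 1 - w ≡ -r [ZMOD m] ∧ n ≤ 2 * (n - 1 - w)) := by
  lift n to ℕ using hn.le
  have hn' : 0 < n := by exact_mod_cast hn
  have key (r' : ℤ) := Nat.card_congr
    (Nat.Partition.equivEraseLargest hn' fun k => k ≡ r' [ZMOD m])
  unfold weightCount
  rw [← key r, ← key (-r), rankCountPlus, if_pos hn, Int.toNat_natCast]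
  have hneg : Nat.card {l : n.Partition // l.rank ≡ -r [ZMOD m] ∧ (n : ℤ) ≤ 2 * l.rank} =
      Nat.card {l : n.Partition // l.rank ≡ r [ZMOD m] ∧ (n : ℤ) ≤ 2 * -l.rank} := by
    refine Nat.card_congr ((Nat.Partition.conjugate_s16 n).subtypeEquiv fun l => ?_)
    rw [Nat.Partition.rank_conjugate_s16, neg_neg]
    refine and_congr_left fun _ => ⟨fun h => by simpa using h.neg, fun h => by simpa using h.neg⟩
  rw [hneg]
  classical
  simp only [Nat.card_eq_fintype_card, Fintype.card_subtype]
  rw [← Finset.card_union_of_disjoint]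
  · congr 1
    ext l
    have habs : ((n : ℤ) : ℚ) / 2 ≤ |(l.rank : ℚ)| ↔
        (n : ℤ) ≤ 2 * l.rank ∨ (n : ℤ) ≤ 2 * -l.rank := by
      rw [le_abs, div_le_iff₀' two_pos, div_le_iff₀' two_pos]
      norm_cast
    simp only [Finset.mem_filter, Finset.mem_univ, true_and, Finset.mem_union, habs, and_or_left]
  · rw [Finset.disjoint_filter]
    intro l _ h h'
    omega

theorem rankCountPlus_ex23 (n : ℤ) (hn : 0 ≤ n) :
    rankCountPlus 1 23 (46 * n + 47) + rankCountPlus (-2) 23 (46 * n + 54)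
      = rankCountPlus 3 23 (46 * n + 49) + rankCountPlus 4 23 (46 * n + 29) := by
  have h {n₁ n₂ r₁ r₂ : ℤ} (h : ∀ w : ℤ,
      ((n₁ - 1 - w) % 23 = r₁ % 23 ∧ n₁ ≤ 2 * (n₁ - 1 - w)) ↔
        ((n₂ - 1 - w) % 23 = r₂ % 23 ∧ n₂ ≤ 2 * (n₂ - 1 - w))) :
      weightCount (fun w => n₁ - 1 - w ≡ r₁ [ZMOD 23] ∧ n₁ ≤ 2 * (n₁ - 1 - w)) =
        weightCount (fun w => n₂ - 1 - w ≡ r₂ [ZMOD 23] ∧ n₂ ≤ 2 * (n₂ - 1 - w)) :=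
    congrArg weightCount (funext fun w => propext (h w))
  rw [rankCountPlus_eq_weightCount (by omega), rankCountPlus_eq_weightCount (by omega),
    rankCountPlus_eq_weightCount (by omega), rankCountPlus_eq_weightCount (by omega)]
  rw [h (n₁ := 46 * n + 47) (n₂ := 46 * n + 49) (r₁ := 1) (r₂ := 3) (by omega),
    h (n₁ := 46 * n + 47) (n₂ := 46 * n + 29) (r₁ := -1) (r₂ := 4) (by omega),
    h (n₁ := 46 * n + 54) (n₂ := 46 * n + 29) (r₁ := -2) (r₂ := -4) (by omega),
    h (n₁ := 46 * n + 54) (n₂ := 46 * n + 49) (r₁ := - -2) (r₂ := -3) (by omega)]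
  omega
end
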